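/- Let μ₁ and μ₂ be bounded charges defined on a common field of sets 𝒜 on X. Let f : X → [0,∞) with f ∈ L1(X,𝒜,μ₁) and f ∈ L1(X,𝒜,μ₂). Suppose E is a dense subset of (0,∞) such that f⁻¹(y,∞) belongs to the Peano-Jordan completion of 𝒜 with respect to both μ₁ and μ₂ for all y ∈ E, and set 𝒯 := {f⁻¹(y,∞) : y ∈ E}. If μ̄₁(A) ≤ μ̄₂(A) for each A ∈ 𝒯, then: (1) ∫ f dμ₁ ≤ ∫ f dμ₂; and (2) for each A ∈ 𝒯, f·1_A ∈ L1(X,𝒜,μ₁) and f·1_A ∈ L1(X,𝒜,μ₂), with ∫ f·1_A dμ₁ ≤ ∫ f·1_A dμ₂. -/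

import Mathlib

open Filter Set Topology

section ChargeDefs

variable {X : Type*}

/-- A field of sets on `X`: contains `∅`, closed under complements and finite unions. -/
structure IsSetField (𝒜 : Set (Set X)) : Prop where
  empty_mem : (∅ : Set X) ∈ 𝒜
  compl_mem : ∀ A ∈ 𝒜, Aᶜ ∈ 𝒜
  union_mem : ∀ A ∈ 𝒜, ∀ B ∈ 𝒜, A ∪ B ∈ 𝒜

/-- A (bounded, non-negative) charge space: a field of sets together with a finitely
additive non-negative real-valued set function vanishing on `∅`.  (The function `μ` is
given on all of `𝒫(X)`; only its values on `𝒜` are constrained or used.) -/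
structure IsCharge (𝒜 : Set (Set X)) (μ : Set X → ℝ) : Prop where
  isSetField : IsSetField 𝒜
  empty : μ ∅ = 0
  nonneg : ∀ A ∈ 𝒜, 0 ≤ μ A
  additive : ∀ A ∈ 𝒜, ∀ B ∈ 𝒜, Disjoint A B → μ (A ∪ B) = μ A + μ B

/-- The outer charge `μ*(A) = inf {μ B : B ∈ 𝒜, A ⊆ B}`. -/
noncomputable def outerCharge (𝒜 : Set (Set X)) (μ : Set X → ℝ) (A : Set X) : ℝ :=
  sInf (μ '' {B | B ∈ 𝒜 ∧ A ⊆ B})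

/-- A null function: `μ*({x : |h x| > ε}) = 0` for every `ε > 0`. -/
def IsNullFn (𝒜 : Set (Set X)) (μ : Set X → ℝ) (h : X → ℝ) : Prop :=
  ∀ ε > (0 : ℝ), outerCharge 𝒜 μ {x | ε < |h x|} = 0

/-- `f = g` almost everywhere: `f - g` is a null function. -/
def EqAE (𝒜 : Set (Set X)) (μ : Set X → ℝ) (f g : X → ℝ) : Prop :=
  IsNullFn 𝒜 μ (fun x => f x - g x)

/-- `f ≤ g` almost everywhere: `f ≤ g + h` for some null function `h`. -/
def LeAE (𝒜 : Set (Set X)) (μ : Set X → ℝ) (f g : X → ℝ) : Prop :=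
  ∃ h : X → ℝ, IsNullFn 𝒜 μ h ∧ ∀ x, f x ≤ g x + h x

/-- Hazy convergence of a sequence of functions. -/
def HazyConv (𝒜 : Set (Set X)) (μ : Set X → ℝ) (fn : ℕ → X → ℝ) (f : X → ℝ) : Prop :=
  ∀ ε > (0 : ℝ), Tendsto (fun n => outerCharge 𝒜 μ {x | ε < |fn n x - f x|}) atTop (𝓝 0)

/-- A simple function w.r.t. the field `𝒜`: `Σ c_k 1_{A_k}` for a finite partition
`{A_k} ⊆ 𝒜` of `X`. -/
def IsSimpleFn (𝒜 : Set (Set X)) (f : X → ℝ) : Prop :=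
  ∃ (n : ℕ) (c : Fin n → ℝ) (A : Fin n → Set X),
    (∀ k, A k ∈ 𝒜) ∧ (Pairwise fun i j => Disjoint (A i) (A j)) ∧
    (⋃ k, A k) = Set.univ ∧ ∀ x, f x = ∑ k, (A k).indicator (fun _ => c k) x

/-- `T₁`-measurability: `f` is the hazy limit of a sequence of simple functions.
`MemL0 𝒜 μ f` says `f ∈ L₀(X,𝒜,μ)`. -/
def MemL0 (𝒜 : Set (Set X)) (μ : Set X → ℝ) (f : X → ℝ) : Prop :=
  ∃ fn : ℕ → X → ℝ, (∀ n, IsSimpleFn 𝒜 (fn n)) ∧ HazyConv 𝒜 μ fn f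

/-- Integral of a simple function: `Σ_y y·μ(f⁻¹{y})` (a finite sum for simple `f`;
for a simple function `Σ c_k 1_{A_k}` over a partition this equals `Σ c_k μ(A_k)`). -/
noncomputable def sIntegral (μ : Set X → ℝ) (f : X → ℝ) : ℝ :=
  ∑ᶠ y, y * μ (f ⁻¹' {y})

/-- A determining sequence for `f`: simple functions converging hazily to `f` with
`∫ |f_n - f_m| dμ → 0` as `m, n → ∞`. -/
def IsDetermining (𝒜 : Set (Set X)) (μ : Set X → ℝ) (fn : ℕ → X → ℝ) (f : X → ℝ) : Prop :=
  (∀ n, IsSimpleFn 𝒜 (fn n)) ∧ HazyConv 𝒜 μ fn f ∧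
    Tendsto (fun mn : ℕ × ℕ => sIntegral μ (fun x => |fn mn.1 x - fn mn.2 x|)) atTop (𝓝 0)

/-- Integrability w.r.t. a charge: existence of a determining sequence.
`MemL1 𝒜 μ f` says `f ∈ L₁(X,𝒜,μ)`. -/
def MemL1 (𝒜 : Set (Set X)) (μ : Set X → ℝ) (f : X → ℝ) : Prop :=
  ∃ fn : ℕ → X → ℝ, IsDetermining 𝒜 μ fn f

-- The integral `∫ f dμ` of an integrable function: the limit of the integrals of
-- any determining sequence (this limit is independent of the choice).
open Classical in
noncomputable def chargeIntegral (𝒜 : Set (Set X)) (μ : Set X → ℝ) (f : X → ℝ) : ℝ :=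
  if h : ∃ fn : ℕ → X → ℝ, IsDetermining 𝒜 μ fn f then
    limUnder atTop (fun n => sIntegral μ (h.choose n))
  else 0

/-- Smoothness: for every `ε > 0` there is `k > 0` with `μ*({x : |f x| > k}) < ε`. -/
def SmoothFn (𝒜 : Set (Set X)) (μ : Set X → ℝ) (f : X → ℝ) : Prop :=
  ∀ ε > (0 : ℝ), ∃ k > (0 : ℝ), outerCharge 𝒜 μ {x | k < |f x|} < ε

/-- The field of the Peano-Jordan completion of `(X,𝒜,μ)`. -/
def pjField (𝒜 : Set (Set X)) (μ : Set X → ℝ) : Set (Set X) :=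
  {A | ∀ ε > (0 : ℝ), ∃ B ∈ 𝒜, ∃ C ∈ 𝒜, B ⊆ A ∧ A ⊆ C ∧ μ (C \ B) < ε}

/-- The charge of the Peano-Jordan completion: `μ̄(A) = sup {μ B : B ∈ 𝒜, B ⊆ A}`. -/
noncomputable def pjCharge (𝒜 : Set (Set X)) (μ : Set X → ℝ) (A : Set X) : ℝ :=
  sSup (μ '' {B | B ∈ 𝒜 ∧ B ⊆ A})

/-- The pseudometric `d` on `L₀`. -/
noncomputable def hazyDist (𝒜 : Set (Set X)) (μ : Set X → ℝ) (f g : X → ℝ) : ℝ :=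
  sInf {ε : ℝ | 0 < ε ∧ outerCharge 𝒜 μ {x | ε < |f x - g x|} < ε}

/-- `f ∈ L_p(X,𝒜,μ)` for `p ∈ [1,∞)`: `f` is `T₁`-measurable and `|f|^p` integrable. -/
def MemLpC (𝒜 : Set (Set X)) (μ : Set X → ℝ) (p : ℝ) (f : X → ℝ) : Prop :=
  MemL0 𝒜 μ f ∧ MemL1 𝒜 μ (fun x => |f x| ^ p)

/-- `f ∈ L_p` for `p ∈ {0} ∪ [1,∞)`. -/
def MemLp' (𝒜 : Set (Set X)) (μ : Set X → ℝ) (p : ℝ) (f : X → ℝ) : Prop :=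
  if p = 0 then MemL0 𝒜 μ f else MemLpC 𝒜 μ p f

/-- The distance on `L_p`: the pseudometric `d` for `p = 0`, and
`‖f - g‖_p = (∫ |f-g|^p dμ)^(1/p)` for `p ≥ 1`. -/
noncomputable def LpDist (𝒜 : Set (Set X)) (μ : Set X → ℝ) (p : ℝ) (f g : X → ℝ) : ℝ :=
  if p = 0 then hazyDist 𝒜 μ f g
  else (chargeIntegral 𝒜 μ fun x => |f x - g x| ^ p) ^ (1 / p)

/-- The collection of null sets of a charge space. -/
def nullSets (𝒜 : Set (Set X)) (μ : Set X → ℝ) : Set (Set X) :=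
  {A | outerCharge 𝒜 μ A = 0}

/-- The smallest field of sets on `X` containing a given collection `𝒞`. -/
def genSetField (𝒞 : Set (Set X)) : Set (Set X) :=
  ⋂₀ {𝒟 | IsSetField 𝒟 ∧ 𝒞 ⊆ 𝒟}

end ChargeDefs


section Helpers

variable {X : Type*} {𝒜 : Set (Set X)} {μ : Set X → ℝ}

theorem IsSetField.univ_mem (h : IsSetField 𝒜) : (Set.univ : Set X) ∈ 𝒜 := by
  have := h.compl_mem _ h.empty_mem
  simpa using this

theorem IsSetField.inter_mem (h : IsSetField 𝒜) {A B : Set X} (hA : A ∈ 𝒜) (hB : B ∈ 𝒜) :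
    A ∩ B ∈ 𝒜 := by
  have := h.compl_mem _ (h.union_mem _ (h.compl_mem _ hA) _ (h.compl_mem _ hB))
  simpa [Set.compl_union] using this

theorem IsSetField.diff_mem (h : IsSetField 𝒜) {A B : Set X} (hA : A ∈ 𝒜) (hB : B ∈ 𝒜) :
    A \ B ∈ 𝒜 := h.inter_mem hA (h.compl_mem _ hB)

theorem IsSetField.biUnion_mem (h : IsSetField 𝒜) {ι : Type*} (T : Finset ι) (A : ι → Set X)
    (hA : ∀ i ∈ T, A i ∈ 𝒜) : (⋃ i ∈ T, A i) ∈ 𝒜 := by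
  classical
  induction T using Finset.induction_on with
  | empty => simpa using h.empty_mem
  | insert a s ha ih =>
    rw [Finset.set_biUnion_insert]
    exact h.union_mem _ (hA a (by simp)) _ (ih fun i hi => hA i (by simp [hi]))

theorem IsCharge.biUnion (h : IsCharge 𝒜 μ) {ι : Type*} (T : Finset ι) (A : ι → Set X)
    (hA : ∀ i ∈ T, A i ∈ 𝒜) (hd : ∀ i j, i ≠ j → Disjoint (A i) (A j)) :
    μ (⋃ i ∈ T, A i) = ∑ i ∈ T, μ (A i) := by
  classical
  induction T using Finset.induction_on with
  | empty => simpa using h.empty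
  | insert a s ha ih =>
    rw [Finset.set_biUnion_insert, Finset.sum_insert ha, ← ih fun i hi => hA i (by simp [hi])]
    refine h.additive _ (hA a (by simp)) _
      (h.isSetField.biUnion_mem s A fun i hi => hA i (by simp [hi])) ?_
    simp only [Set.disjoint_iUnion_right]
    intro i hi
    exact hd _ _ (by rintro rfl; exact ha hi)

theorem IsCharge.mono (h : IsCharge 𝒜 μ) {A B : Set X} (hA : A ∈ 𝒜) (hB : B ∈ 𝒜)
    (hAB : A ⊆ B) : μ B = μ A + μ (B \ A) := by
  rw [← h.additive _ hA _ (h.isSetField.diff_mem hB hA) Set.disjoint_sdiff_right,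
    Set.union_diff_cancel hAB]

theorem IsCharge.le (h : IsCharge 𝒜 μ) {A B : Set X} (hA : A ∈ 𝒜) (hB : B ∈ 𝒜)
    (hAB : A ⊆ B) : μ A ≤ μ B := by
  rw [h.mono hA hB hAB]
  linarith [h.nonneg _ (h.isSetField.diff_mem hB hA)]

theorem IsCharge.union_le (h : IsCharge 𝒜 μ) {A B : Set X} (hA : A ∈ 𝒜) (hB : B ∈ 𝒜) :
    μ (A ∪ B) ≤ μ A + μ B := by
  have h1 := h.mono hA (h.isSetField.union_mem _ hA _ hB) Set.subset_union_left
  have h2 := h.le (h.isSetField.diff_mem (h.isSetField.union_mem _ hA _ hB) hA) hB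
    (by intro x; simp; tauto)
  linarith

/-- Finite range, with fibres in the field. -/
def SF (𝒜 : Set (Set X)) {Y : Type*} (h : X → Y) : Prop :=
  (Set.range h).Finite ∧ ∀ y, h ⁻¹' {y} ∈ 𝒜

theorem SF.preimage (hF : IsSetField 𝒜) {Y : Type*} {h : X → Y} (hh : SF 𝒜 h) (S : Set Y) :
    h ⁻¹' S ∈ 𝒜 := by
  classical
  have : h ⁻¹' S = ⋃ y ∈ hh.1.toFinset.filter (· ∈ S), h ⁻¹' {y} := by
    ext x; simp
  rw [this]
  exact hF.biUnion_mem _ _ fun i _ => hh.2 i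

theorem SF.comp (hF : IsSetField 𝒜) {Y Z : Type*} {h : X → Y} (hh : SF 𝒜 h) (φ : Y → Z) :
    SF 𝒜 (fun x => φ (h x)) := by
  refine ⟨?_, fun z => ?_⟩
  · have : Set.range (fun x => φ (h x)) = φ '' Set.range h := by
      ext; simp
    rw [this]; exact hh.1.image _
  · exact hh.preimage hF (φ ⁻¹' {z})

theorem SF.pair (hF : IsSetField 𝒜) {Y Z : Type*} {h : X → Y} {g : X → Z} (hh : SF 𝒜 h)
    (hg : SF 𝒜 g) : SF 𝒜 (fun x => (h x, g x)) := by
  refine ⟨(hh.1.prod hg.1).subset ?_, fun z => ?_⟩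
  · rintro _ ⟨x, rfl⟩; simp
  · have : (fun x => (h x, g x)) ⁻¹' {z} = h ⁻¹' {z.1} ∩ g ⁻¹' {z.2} := by
      ext x; simp [Prod.ext_iff]
    rw [this]; exact hF.inter_mem (hh.2 _) (hg.2 _)

theorem SF.mem (hF : IsSetField 𝒜) {B : Set X} (hB : B ∈ 𝒜) : SF 𝒜 (fun x => x ∈ B) := by
  refine ⟨Set.toFinite _, fun p => ?_⟩
  by_cases hp : p
  · have : (fun x => x ∈ B) ⁻¹' {p} = B := by ext x; simp [hp]
    rw [this]; exact hB
  · have : (fun x => x ∈ B) ⁻¹' {p} = Bᶜ := by ext x; simp [hp]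
    rw [this]; exact hF.compl_mem _ hB

theorem SF.const (hF : IsSetField 𝒜) (c : ℝ) : SF 𝒜 (fun _ : X => c) :=
  (SF.mem hF hF.univ_mem).comp hF fun _ => c

theorem SF.ind (hF : IsSetField 𝒜) {B : Set X} (hB : B ∈ 𝒜) (c : ℝ) :
    SF 𝒜 (B.indicator fun _ => c) := by
  classical
  have := (SF.mem hF hB).comp hF fun p => if p then c else 0
  convert this using 1
  ext x; simp [Set.indicator]

theorem SF.add (hF : IsSetField 𝒜) {f g : X → ℝ} (hf : SF 𝒜 f) (hg : SF 𝒜 g) :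
    SF 𝒜 (fun x => f x + g x) := (hf.pair hF hg).comp hF fun p => p.1 + p.2

theorem SF.absub (hF : IsSetField 𝒜) {f g : X → ℝ} (hf : SF 𝒜 f) (hg : SF 𝒜 g) :
    SF 𝒜 (fun x => |f x - g x|) := (hf.pair hF hg).comp hF fun p => |p.1 - p.2|

theorem SF.neg (hF : IsSetField 𝒜) {f : X → ℝ} (hf : SF 𝒜 f) :
    SF 𝒜 (fun x => - f x) := hf.comp hF fun p => - p

theorem SF.sum (hF : IsSetField 𝒜) {ι : Type*} (T : Finset ι) {f : ι → X → ℝ}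
    (hf : ∀ i ∈ T, SF 𝒜 (f i)) :
    SF 𝒜 (fun x => ∑ i ∈ T, f i x) := by
  classical
  induction T using Finset.induction_on with
  | empty => simpa using SF.const hF 0
  | insert a s ha ih =>
    simp only [Finset.sum_insert ha]
    exact (hf a (by simp)).add hF (ih fun i hi => hf i (by simp [hi]))

theorem SF.bdd {f : X → ℝ} (hf : SF 𝒜 f) : ∃ M > 0, ∀ x, |f x| ≤ M := by
  have := (hf.1.image abs).bddAbove
  obtain ⟨M, hM⟩ := this
  refine ⟨max M 1, by positivity, fun x => le_max_of_le_left (hM ⟨f x, by simp, rfl⟩)⟩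

theorem isSimpleFn_iff (hF : IsSetField 𝒜) {f : X → ℝ} : IsSimpleFn 𝒜 f ↔ SF 𝒜 f := by
  classical
  constructor
  · rintro ⟨n, c, A, hA, -, -, hf⟩
    have : f = fun x => ∑ k, (A k).indicator (fun _ => c k) x := funext hf
    rw [this]
    exact SF.sum hF _ fun i _ => SF.ind hF (hA i) _
  · intro hf
    have e := hf.1.toFinset.equivFin.symm
    refine ⟨_, fun i => (e i : ℝ), fun i => f ⁻¹' {(e i : ℝ)}, fun i => hf.2 _, ?_, ?_, ?_⟩
    · intro i j hij
      change Disjoint (f ⁻¹' {(e i : ℝ)}) (f ⁻¹' {(e j : ℝ)})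
      refine Disjoint.preimage f ?_
      simp only [Set.disjoint_singleton]
      intro h
      exact hij (e.injective (Subtype.ext h))
    · ext x
      simp only [Set.mem_iUnion, Set.mem_preimage, Set.mem_singleton_iff, Set.mem_univ, iff_true]
      exact ⟨e.symm ⟨f x, by simp⟩, by simp⟩
    · intro x
      rw [Finset.sum_eq_single (e.symm ⟨f x, by simp⟩)]
      · simp
      · intro b _ hb
        apply Set.indicator_of_notMem
        intro h
        apply hb
        rw [Equiv.eq_symm_apply]
        exact Subtype.ext h.symm
      · simp

theorem sIntegral_comp (hμ : IsCharge 𝒜 μ) {Y : Type*} {h : X → Y} (hh : SF 𝒜 h) (T : Finset Y)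
    (hT : ∀ x, h x ∈ T) (φ : Y → ℝ) :
    sIntegral μ (fun x => φ (h x)) = ∑ y ∈ T, φ y * μ (h ⁻¹' {y}) := by
  classical
  unfold sIntegral
  rw [finsum_eq_sum_of_support_subset (s := T.image φ)]
  · rw [← Finset.sum_fiberwise_of_maps_to (g := φ) (t := T.image φ)
      (fun i hi => Finset.mem_image_of_mem _ hi)]
    refine Finset.sum_congr rfl fun z _ => ?_
    have : (fun x => φ (h x)) ⁻¹' {z} = ⋃ y ∈ T.filter (φ · = z), h ⁻¹' {y} := by
      ext x; simp [hT]
    rw [this, hμ.biUnion _ _ (fun i _ => hh.2 i), Finset.mul_sum]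
    · refine Finset.sum_congr rfl fun y hy => ?_
      rw [(Finset.mem_filter.1 hy).2]
    · intro i j hij
      exact Disjoint.preimage h (by simpa using hij)
  · intro z hz
    by_contra hc
    apply hz
    have : (fun x => φ (h x)) ⁻¹' {z} = ∅ := by
      ext x
      simp only [Set.mem_preimage, Set.mem_singleton_iff, Set.mem_empty_iff_false, iff_false]
      intro hx
      exact hc (by rw [← hx]; exact_mod_cast Finset.mem_image_of_mem _ (hT x))
    simp [this, hμ.empty]

theorem sIntegral_add (hμ : IsCharge 𝒜 μ) {f g : X → ℝ} (hf : SF 𝒜 f) (hg : SF 𝒜 g) :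
    sIntegral μ (fun x => f x + g x) = sIntegral μ f + sIntegral μ g := by
  have hp := hf.pair hμ.isSetField hg
  have hT : ∀ x, (f x, g x) ∈ hp.1.toFinset := fun x => (Set.Finite.mem_toFinset _).2 ⟨x, rfl⟩
  have e1 := sIntegral_comp hμ hp _ hT fun p => p.1 + p.2
  have e2 := sIntegral_comp hμ hp _ hT fun p => p.1
  have e3 := sIntegral_comp hμ hp _ hT fun p => p.2
  simp only at e1 e2 e3
  rw [e1, e2, e3, ← Finset.sum_add_distrib]
  exact Finset.sum_congr rfl fun _ _ => by ring

theorem sIntegral_mono (hμ : IsCharge 𝒜 μ) {f g : X → ℝ} (hf : SF 𝒜 f) (hg : SF 𝒜 g)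
    (hfg : ∀ x, f x ≤ g x) :
    sIntegral μ f ≤ sIntegral μ g := by
  have hp := hf.pair hμ.isSetField hg
  have hT : ∀ x, (f x, g x) ∈ hp.1.toFinset := fun x => (Set.Finite.mem_toFinset _).2 ⟨x, rfl⟩
  have e2 := sIntegral_comp hμ hp _ hT fun p => p.1
  have e3 := sIntegral_comp hμ hp _ hT fun p => p.2
  simp only at e2 e3
  rw [e2, e3]
  refine Finset.sum_le_sum fun p hp' => ?_
  refine mul_le_mul_of_nonneg_right ?_ (hμ.nonneg _ (hp.2 p))
  obtain ⟨x, rfl⟩ := (Set.Finite.mem_toFinset _).1 hp'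
  exact hfg x

theorem sIntegral_neg (hμ : IsCharge 𝒜 μ) {f : X → ℝ} (hf : SF 𝒜 f) :
    sIntegral μ (fun x => - f x) = - sIntegral μ f := by
  have hT : ∀ x, f x ∈ hf.1.toFinset := by simp
  have e2 := sIntegral_comp hμ hf _ hT fun p => -p
  have e3 : sIntegral μ f = _ := sIntegral_comp hμ hf _ hT fun p => p
  rw [e2, e3, ← Finset.sum_neg_distrib]
  exact Finset.sum_congr rfl fun _ _ => by ring

theorem sIntegral_ind (hμ : IsCharge 𝒜 μ) {B : Set X} (hB : B ∈ 𝒜) (c : ℝ) :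
    sIntegral μ (B.indicator fun _ => c) = c * μ B := by
  classical
  have := sIntegral_comp hμ (SF.mem hμ.isSetField hB) Finset.univ (fun _ => Finset.mem_univ _)
    fun p => if p then c else 0
  have e : (B.indicator fun _ => c) = fun x => if x ∈ B then c else 0 := by
    ext x; simp [Set.indicator]
  have e2 : (fun x => x ∈ B) ⁻¹' {True} = B := by ext x; simp
  rw [e, this]
  simp [Fintype.univ_Prop, e2]

theorem sIntegral_const (hμ : IsCharge 𝒜 μ) (c : ℝ) :
    sIntegral μ (fun _ : X => c) = c * μ Set.univ := by
  have := sIntegral_ind hμ hμ.isSetField.univ_mem c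
  simpa using this

theorem sIntegral_sum (hμ : IsCharge 𝒜 μ) {ι : Type*} (T : Finset ι) {f : ι → X → ℝ}
    (hf : ∀ i ∈ T, SF 𝒜 (f i)) :
    sIntegral μ (fun x => ∑ i ∈ T, f i x) = ∑ i ∈ T, sIntegral μ (f i) := by
  classical
  induction T using Finset.induction_on with
  | empty => simpa using sIntegral_const hμ 0
  | insert a s ha ih =>
    have hs : ∀ i ∈ s, SF 𝒜 (f i) := fun i hi => hf i (by simp [hi])
    simp only [Finset.sum_insert ha]
    rw [sIntegral_add hμ (hf a (by simp)) (SF.sum hμ.isSetField s hs), ih hs]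

theorem exists_of_outer_lt (hμ : IsCharge 𝒜 μ) {A : Set X} {η : ℝ}
    (h : outerCharge 𝒜 μ A < η) : ∃ C ∈ 𝒜, A ⊆ C ∧ μ C < η := by
  have hne : (μ '' {B | B ∈ 𝒜 ∧ A ⊆ B}).Nonempty :=
    ⟨_, Set.univ, ⟨hμ.isSetField.univ_mem, Set.subset_univ _⟩, rfl⟩
  obtain ⟨_, ⟨C, hC, rfl⟩, h'⟩ := exists_lt_of_csInf_lt hne h
  exact ⟨C, hC.1, hC.2, h'⟩

theorem outer_le (hμ : IsCharge 𝒜 μ) {A C : Set X} (hC : C ∈ 𝒜) (hAC : A ⊆ C) :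
    outerCharge 𝒜 μ A ≤ μ C := by
  refine csInf_le ⟨0, ?_⟩ ⟨C, ⟨hC, hAC⟩, rfl⟩
  rintro _ ⟨B, hB, rfl⟩
  exact hμ.nonneg _ hB.1

theorem outer_nonneg (hμ : IsCharge 𝒜 μ) (A : Set X) : 0 ≤ outerCharge 𝒜 μ A := by
  apply Real.sInf_nonneg
  rintro _ ⟨B, hB, rfl⟩
  exact hμ.nonneg _ hB.1

theorem IsDetermining.cauchy {fn : ℕ → X → ℝ} {f : X → ℝ}
    (hd : IsDetermining 𝒜 μ fn f) {ε : ℝ} (hε : 0 < ε) :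
    ∃ N, ∀ n ≥ N, ∀ m ≥ N, sIntegral μ (fun x => |fn n x - fn m x|) < ε := by
  have := hd.2.2.eventually (gt_mem_nhds hε)
  obtain ⟨⟨a, b⟩, hab⟩ := eventually_atTop.1 this
  exact ⟨max a b, fun n hn m hm => hab (n, m)
    (Prod.mk_le_mk.2 ⟨(le_max_left _ _).trans hn, (le_max_right _ _).trans hm⟩)⟩

theorem IsDetermining.sf (hμ : IsCharge 𝒜 μ) {fn : ℕ → X → ℝ} {f : X → ℝ}
    (hd : IsDetermining 𝒜 μ fn f) (n : ℕ) : SF 𝒜 (fn n) :=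
  (isSimpleFn_iff hμ.isSetField).1 (hd.1 n)

theorem IsDetermining.neg (hμ : IsCharge 𝒜 μ) {fn : ℕ → X → ℝ} {f : X → ℝ}
    (hd : IsDetermining 𝒜 μ fn f) :
    IsDetermining 𝒜 μ (fun n x => - fn n x) (fun x => - f x) := by
  refine ⟨fun n => (isSimpleFn_iff hμ.isSetField).2 ((hd.sf hμ n).neg hμ.isSetField), ?_, ?_⟩
  · intro ε hε
    have := hd.2.1 ε hε
    convert this using 5 with n x
    rw [← abs_neg]; ring_nf
  · convert hd.2.2 using 4 with mn x
    rw [← abs_neg]; ring_nf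

theorem sIntegral_sub_le (hμ : IsCharge 𝒜 μ) {f g : X → ℝ} (hf : SF 𝒜 f) (hg : SF 𝒜 g) :
    sIntegral μ f ≤ sIntegral μ g + sIntegral μ (fun x => |f x - g x|) := by
  have hF := hμ.isSetField
  rw [← sIntegral_add hμ hg (hf.absub hF hg)]
  refine sIntegral_mono hμ hf (hg.add hF (hf.absub hF hg)) fun x => ?_
  linarith [le_abs_self (f x - g x)]

theorem exists_determining (hμ : IsCharge 𝒜 μ) {f : X → ℝ} (hf : MemL1 𝒜 μ f) :
    ∃ fn, IsDetermining 𝒜 μ fn f ∧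
      Tendsto (fun n => sIntegral μ (fn n)) atTop (𝓝 (chargeIntegral 𝒜 μ f)) := by
  unfold MemL1 at hf
  have hd := hf.choose_spec
  refine ⟨hf.choose, hd, ?_⟩
  unfold chargeIntegral
  rw [dif_pos hf]
  refine tendsto_nhds_limUnder (cauchySeq_tendsto_of_complete ?_)
  rw [Metric.cauchySeq_iff]
  intro ε hε
  obtain ⟨N, hN⟩ := hd.cauchy hε
  refine ⟨N, fun m hm n hn => ?_⟩
  have h1 := sIntegral_sub_le hμ (hd.sf hμ m) (hd.sf hμ n)
  have h2 := sIntegral_sub_le hμ (hd.sf hμ n) (hd.sf hμ m)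
  have h3 := hN m hm n hn
  have h4 := hN n hn m hm
  rw [Real.dist_eq, abs_lt]
  constructor <;> linarith

theorem upper_aux (hμ : IsCharge 𝒜 μ) {fn : ℕ → X → ℝ} {f : X → ℝ} {I : ℝ}
    (hd : IsDetermining 𝒜 μ fn f) (hI : Tendsto (fun n => sIntegral μ (fn n)) atTop (𝓝 I))
    {ε : ℝ} (hε : 0 < ε) :
    ∃ M > 0, ∀ u : X → ℝ, SF 𝒜 u → ∀ δ > 0, (∀ x, min (f x) M ≤ u x + δ) →
      I ≤ sIntegral μ u + δ * μ Set.univ + ε := by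
  have hF := hμ.isSetField
  have hm := hμ.nonneg _ hF.univ_mem
  obtain ⟨N, hN⟩ := hd.cauchy (half_pos (half_pos hε))
  obtain ⟨M, hM0, hM⟩ := (hd.sf hμ N).bdd
  refine ⟨M, hM0, fun u hu δ hδ hfu => ?_⟩
  obtain ⟨K, hK0, hK⟩ := hu.bdd
  set δ' : ℝ := ε / 4 / (μ Set.univ + 1) with hδ'
  have hδ'0 : 0 < δ' := by positivity
  have hδ'1 : δ' * μ Set.univ ≤ ε / 4 := by
    rw [hδ', div_mul_eq_mul_div, div_le_iff₀ (by positivity)]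
    nlinarith
  have hη : 0 < ε / 4 / (M + K) := by positivity
  refine le_of_tendsto hI ?_
  filter_upwards [eventually_ge_atTop N, (hd.2.1 δ' hδ'0).eventually (gt_mem_nhds hη)] with n hn hC
  obtain ⟨C, hCA, hsub, hCμ⟩ := exists_of_outer_lt hμ hC
  have hsn := hd.sf hμ n
  have hab := hsn.absub hF (hd.sf hμ N)
  have hi := SF.ind hF hCA (M + K)
  have hc := SF.const (X := X) hF (δ + δ')
  have key : ∀ x, fn n x ≤ (u x + (δ + δ')) +
      (C.indicator (fun _ => M + K) x + |fn n x - fn N x|) := by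
    intro x
    have a1 := le_abs_self (fn n x - fn N x)
    have a2 := abs_le.1 (hM x)
    have a3 := abs_le.1 (hK x)
    have a4 := abs_nonneg (fn n x - fn N x)
    by_cases hx : x ∈ C
    · rw [Set.indicator_of_mem hx]; linarith [a2.2, a3.1]
    · rw [Set.indicator_of_notMem hx]
      have : |fn n x - f x| ≤ δ' := by
        by_contra hcon
        exact hx (hsub (not_le.1 hcon))
      have a5 := abs_le.1 this
      rcases min_le_iff.1 (hfu x) with h | h
      · linarith [a5.2]
      · linarith [a2.2]
  have h1 := sIntegral_mono hμ hsn ((hu.add hF hc).add hF (hi.add hF hab)) key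
  rw [sIntegral_add hμ (hu.add hF hc) (hi.add hF hab), sIntegral_add hμ hu hc,
    sIntegral_add hμ hi hab, sIntegral_const hμ, sIntegral_ind hμ hCA] at h1
  have h2 := hN n hn N le_rfl
  have h3 : (M + K) * μ C ≤ ε / 4 := by
    rw [lt_div_iff₀ (by positivity)] at hCμ
    linarith
  linarith

theorem lower_aux (hμ : IsCharge 𝒜 μ) {fn : ℕ → X → ℝ} {f : X → ℝ} {I : ℝ}
    (hd : IsDetermining 𝒜 μ fn f) (hI : Tendsto (fun n => sIntegral μ (fn n)) atTop (𝓝 I))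
    {s : X → ℝ} (hs : SF 𝒜 s) {δ : ℝ} (hδ : 0 < δ) (hsf : ∀ x, s x ≤ f x + δ) :
    sIntegral μ s ≤ I + δ * μ Set.univ := by
  refine le_of_forall_pos_le_add fun ε hε => ?_
  have hI' : Tendsto (fun n => sIntegral μ (fun x => - fn n x)) atTop (𝓝 (-I)) := by
    have := hI.neg
    refine this.congr fun n => (sIntegral_neg hμ (hd.sf hμ n)).symm
  obtain ⟨M, -, hM⟩ := upper_aux hμ (hd.neg hμ) hI' hε
  have := hM _ (hs.neg hμ.isSetField) δ hδ fun x =>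
    (min_le_left _ _).trans (by linarith [hsf x])
  rw [sIntegral_neg hμ hs] at this
  linarith

theorem approx_sets {μ₁ μ₂ : Set X → ℝ} (h1 : IsCharge 𝒜 μ₁) (_h2 : IsCharge 𝒜 μ₂) {A : Set X}
    (hA : A ∈ pjField 𝒜 μ₁) (hle : pjCharge 𝒜 μ₁ A ≤ pjCharge 𝒜 μ₂ A) {η : ℝ} (hη : 0 < η) :
    ∃ B ∈ 𝒜, ∃ C ∈ 𝒜, B ⊆ A ∧ A ⊆ C ∧ μ₁ C ≤ μ₂ B + η := by
  obtain ⟨B1, hB1, C, hC, hBA, hAC, hlt⟩ := hA (η / 2) (half_pos hη)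
  have e1 : μ₁ B1 ≤ pjCharge 𝒜 μ₁ A := by
    refine le_csSup ⟨μ₁ Set.univ, ?_⟩ ⟨B1, ⟨hB1, hBA⟩, rfl⟩
    rintro _ ⟨D, hD, rfl⟩
    exact h1.le hD.1 h1.isSetField.univ_mem (Set.subset_univ _)
  have e2 : pjCharge 𝒜 μ₂ A - η / 2 < pjCharge 𝒜 μ₂ A := by linarith
  have hne : (μ₂ '' {B | B ∈ 𝒜 ∧ B ⊆ A}).Nonempty :=
    ⟨_, ∅, ⟨h1.isSetField.empty_mem, Set.empty_subset _⟩, rfl⟩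
  obtain ⟨_, ⟨B, hB, rfl⟩, e3⟩ := exists_lt_of_lt_csSup hne e2
  refine ⟨B, hB.1, C, hC, hB.2, hAC, ?_⟩
  have := h1.mono hB1 hC (hBA.trans hAC)
  linarith

theorem order_main (μ₁ μ₂ : Set X → ℝ)
    (h1 : IsCharge 𝒜 μ₁) (h2 : IsCharge 𝒜 μ₂)
    (f : X → ℝ) (hf0 : ∀ x, 0 ≤ f x)
    (hf1 : MemL1 𝒜 μ₁ f) (hf2 : MemL1 𝒜 μ₂ f)
    (E : Set ℝ) (hEdense : Set.Ioi (0 : ℝ) ⊆ closure E)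
    (hT : ∀ y ∈ E, f ⁻¹' Set.Ioi y ∈ pjField 𝒜 μ₁)
    (hle : ∀ y ∈ E, pjCharge 𝒜 μ₁ (f ⁻¹' Set.Ioi y) ≤ pjCharge 𝒜 μ₂ (f ⁻¹' Set.Ioi y)) :
    chargeIntegral 𝒜 μ₁ f ≤ chargeIntegral 𝒜 μ₂ f := by
  have hF := h1.isSetField
  obtain ⟨fn, hd1, hI1⟩ := exists_determining h1 hf1
  obtain ⟨gn, hd2, hI2⟩ := exists_determining h2 hf2
  have hm1 := h1.nonneg _ hF.univ_mem
  have hm2 := h2.nonneg _ hF.univ_mem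
  refine le_of_forall_pos_le_add fun ε hε => ?_
  obtain ⟨M, hM0, hM⟩ := upper_aux h1 hd1 hI1 (half_pos hε)
  set δ : ℝ := ε / 4 / (μ₁ Set.univ + μ₂ Set.univ + 1) with hδ
  have hδ0 : 0 < δ := by positivity
  have hδ1 : δ * (μ₁ Set.univ + μ₂ Set.univ) ≤ ε / 4 := by
    rw [hδ, div_mul_eq_mul_div, div_le_iff₀ (by positivity)]
    nlinarith
  obtain ⟨k, hk⟩ := exists_nat_ge (M / δ)
  rw [div_le_iff₀ hδ0] at hk
  have hη : 0 < ε / 4 / (k * δ + 1) := by positivity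
  have hη1 : k * (δ * (ε / 4 / (k * δ + 1))) ≤ ε / 4 := by
    rw [← mul_assoc, mul_div_assoc', div_le_iff₀ (by positivity)]
    nlinarith
  set η := ε / 4 / (k * δ + 1)
  have hw : ∀ j : ℕ, ∃ w ∈ E, (j : ℝ) * δ < w ∧ w < (j + 1) * δ := by
    intro j
    have hj : (0 : ℝ) ≤ j * δ := by positivity
    have hmem : ((j : ℝ) + 1 / 2) * δ ∈ closure E := hEdense (by simp only [Set.mem_Ioi]; nlinarith)
    obtain ⟨w, hw1, hw2⟩ := mem_closure_iff.1 hmem (Set.Ioo (j * δ) ((j + 1) * δ)) isOpen_Ioo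
      ⟨by nlinarith, by nlinarith⟩
    exact ⟨w, hw2, hw1.1, hw1.2⟩
  choose w hwE hw1 hw2 using hw
  choose B hB C hC hBA hAC hμ using fun j =>
    approx_sets h1 h2 (hT _ (hwE j)) (hle _ (hwE j)) hη
  have hsB : ∀ j ∈ Finset.range k, SF 𝒜 ((B j).indicator fun _ => δ) :=
    fun j _ => SF.ind hF (hB j) δ
  have hsC : ∀ j ∈ Finset.range k, SF 𝒜 ((C j).indicator fun _ => δ) :=
    fun j _ => SF.ind hF (hC j) δ
  have hup : ∀ x, ∀ k : ℕ, ∑ j ∈ Finset.range k, (B j).indicator (fun _ => δ) x ≤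
      min (f x + δ) (k * δ) := by
    intro x k
    induction k with
    | zero => simpa using by linarith [hf0 x]
    | succ k ih =>
      rw [Finset.sum_range_succ]
      have i1 := ih.trans (min_le_left _ _)
      have i2 := ih.trans (min_le_right _ _)
      push_cast
      by_cases hx : x ∈ B k
      · rw [Set.indicator_of_mem hx]
        have h3 : w k < f x := hBA k hx
        have := hw1 k
        refine le_min ?_ ?_ <;> linarith
      · rw [Set.indicator_of_notMem hx]
        refine le_min ?_ ?_ <;> linarith
  have hlow : ∀ x, ∀ k : ℕ, min (f x - δ) (k * δ) ≤
      ∑ j ∈ Finset.range k, (C j).indicator (fun _ => δ) x := by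
    intro x k
    induction k with
    | zero => simp
    | succ k ih =>
      rw [Finset.sum_range_succ]
      push_cast
      by_cases hx : x ∈ C k
      · rw [Set.indicator_of_mem hx]
        rcases min_le_iff.1 ih with h | h
        · exact (min_le_left _ _).trans (by linarith)
        · exact (min_le_right _ _).trans (by linarith)
      · rw [Set.indicator_of_notMem hx]
        have h3 : f x ≤ w k := by
          by_contra hcon
          exact hx (hAC k (not_le.1 hcon))
        have := hw2 k
        rcases min_le_iff.1 ih with h | h
        · exact (min_le_left _ _).trans (by linarith)
        · exact (min_le_left _ _).trans (by linarith)
  have k1 := hM _ (SF.sum hF _ hsC) δ hδ0 (fun x => by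
    rcases min_le_iff.1 (hlow x k) with h | h
    · exact (min_le_left _ _).trans (by linarith)
    · exact (min_le_right _ _).trans (by linarith))
  have k2 := lower_aux h2 hd2 hI2 (SF.sum hF _ hsB) hδ0
    (fun x => (hup x k).trans (min_le_left _ _))
  rw [sIntegral_sum h1 _ hsC] at k1
  rw [sIntegral_sum h2 _ hsB] at k2
  have k3 : ∑ j ∈ Finset.range k, sIntegral μ₁ ((C j).indicator fun _ => δ) ≤
      ∑ j ∈ Finset.range k, sIntegral μ₂ ((B j).indicator fun _ => δ) + k * (δ * η) := by
    have : (k : ℝ) * (δ * η) = ∑ j ∈ Finset.range k, δ * η := by simp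
    rw [this, ← Finset.sum_add_distrib]
    refine Finset.sum_le_sum fun j _ => ?_
    rw [sIntegral_ind h1 (hC j), sIntegral_ind h2 (hB j), ← mul_add]
    exact mul_le_mul_of_nonneg_left (hμ j) hδ0.le
  linarith

theorem memL1_indicator (hμ : IsCharge 𝒜 μ) {f : X → ℝ} (hf : MemL1 𝒜 μ f) {A : Set X}
    (hA : A ∈ pjField 𝒜 μ) : MemL1 𝒜 μ (A.indicator f) := by
  classical
  have hF := hμ.isSetField
  obtain ⟨fn, hd⟩ := hf
  choose B hB C hC hBA hAC hlt using fun n : ℕ => hA (1 / ((n : ℝ) + 1)) (by positivity)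
  have hlim : Tendsto (fun n => μ (C n \ B n)) atTop (𝓝 0) :=
    squeeze_zero (fun n => hμ.nonneg _ (hF.diff_mem (hC n) (hB n))) (fun n => (hlt n).le)
      tendsto_one_div_add_atTop_nhds_zero_nat
  have hg : ∀ n, SF 𝒜 ((B n).indicator (fn n)) := by
    intro n
    have := ((SF.mem hF (hB n)).pair hF (hd.sf hμ n)).comp hF fun p => if p.1 then p.2 else 0
    convert this using 1
    ext x; simp [Set.indicator]
  refine ⟨fun n => (B n).indicator (fn n), fun n => (isSimpleFn_iff hF).2 (hg n), ?_, ?_⟩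
  · intro ε hε
    rw [Metric.tendsto_atTop']
    intro η hη
    have := ((hd.2.1 ε hε).eventually (gt_mem_nhds (half_pos hη))).and
      (hlim.eventually (gt_mem_nhds (half_pos hη)))
    obtain ⟨N, hN⟩ := eventually_atTop.1 this
    refine ⟨N, fun n hn => ?_⟩
    obtain ⟨h1, h2⟩ := hN n hn.le
    obtain ⟨D, hD, hsub, hDμ⟩ := exists_of_outer_lt hμ h1
    rw [Real.dist_eq, sub_zero, abs_of_nonneg (outer_nonneg hμ _)]
    have hCB := hF.diff_mem (hC n) (hB n)
    refine (outer_le hμ (hF.union_mem _ hD _ hCB) ?_).trans_lt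
      ((hμ.union_le hD hCB).trans_lt (by linarith))
    intro x hx
    simp only [Set.mem_setOf_eq] at hx
    by_cases hxB : x ∈ B n
    · rw [Set.indicator_of_mem hxB, Set.indicator_of_mem (hBA n hxB)] at hx
      exact Or.inl (hsub hx)
    · by_cases hxA : x ∈ A
      · exact Or.inr ⟨hAC n hxA, hxB⟩
      · rw [Set.indicator_of_notMem hxB, Set.indicator_of_notMem hxA] at hx
        simp at hx; linarith
  · rw [Metric.tendsto_nhds]
    intro ε hε
    obtain ⟨N, hN⟩ := hd.cauchy (show 0 < ε / 4 by positivity)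
    obtain ⟨M, hM0, hM⟩ := (hd.sf hμ N).bdd
    obtain ⟨N', hN'⟩ := eventually_atTop.1
      (hlim.eventually (gt_mem_nhds (show 0 < ε / 4 / M by positivity)))
    filter_upwards [eventually_ge_atTop (max N N', max N N')] with p hp
    obtain ⟨n, m⟩ := p
    obtain ⟨hn, hm⟩ := Prod.mk_le_mk.1 hp
    have n1 := (le_max_left _ _).trans hn
    have n2 := (le_max_right _ _).trans hn
    have m1 := (le_max_left _ _).trans hm
    have m2 := (le_max_right _ _).trans hm
    have q1 := hN n n1 m m1
    have q2 := hN m m1 N le_rfl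
    have q3 := hN' n n2
    have q4 := hN' m m2
    rw [lt_div_iff₀ hM0] at q3 q4
    have sa := (hg n).absub hF (hg m)
    have s1 := (hd.sf hμ n).absub hF (hd.sf hμ m)
    have s2 := (hd.sf hμ m).absub hF (hd.sf hμ N)
    have c1 := hF.diff_mem (hC n) (hB n)
    have c2 := hF.diff_mem (hC m) (hB m)
    have s3 := SF.ind hF c1 M
    have s4 := SF.ind hF c2 M
    have key : ∀ x, |(B n).indicator (fn n) x - (B m).indicator (fn m) x| ≤
        (|fn n x - fn m x| + |fn m x - fn N x|) +
        ((C n \ B n).indicator (fun _ => M) x + (C m \ B m).indicator (fun _ => M) x) := by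
      intro x
      have t1 := abs_nonneg (fn n x - fn m x)
      have t2 := abs_nonneg (fn m x - fn N x)
      have t3 : 0 ≤ (C n \ B n).indicator (fun _ => M) x :=
        Set.indicator_nonneg (fun _ _ => hM0.le) x
      have t4 : 0 ≤ (C m \ B m).indicator (fun _ => M) x :=
        Set.indicator_nonneg (fun _ _ => hM0.le) x
      have t5 : |fn m x| ≤ |fn m x - fn N x| + M := by
        have := abs_add_le (fn m x - fn N x) (fn N x)
        rw [sub_add_cancel] at this
        linarith [hM x]
      have t6 : |fn n x| ≤ |fn n x - fn m x| + |fn m x| := by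
        have := abs_add_le (fn n x - fn m x) (fn m x)
        rwa [sub_add_cancel] at this
      by_cases hxn : x ∈ B n <;> by_cases hxm : x ∈ B m
      · rw [Set.indicator_of_mem hxn, Set.indicator_of_mem hxm]; linarith
      · rw [Set.indicator_of_mem hxn, Set.indicator_of_notMem hxm, sub_zero,
          Set.indicator_of_mem (s := C m \ B m) ⟨hAC m (hBA n hxn), hxm⟩]
        linarith
      · rw [Set.indicator_of_mem hxm, Set.indicator_of_notMem hxn, zero_sub, abs_neg,
          Set.indicator_of_mem (s := C n \ B n) ⟨hAC n (hBA m hxm), hxn⟩]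
        linarith
      · rw [Set.indicator_of_notMem hxm, Set.indicator_of_notMem hxn, sub_zero, abs_zero]
        linarith
    have h1 := sIntegral_mono hμ sa ((s1.add hF s2).add hF (s3.add hF s4)) key
    rw [sIntegral_add hμ (s1.add hF s2) (s3.add hF s4), sIntegral_add hμ s1 s2,
      sIntegral_add hμ s3 s4, sIntegral_ind hμ c1, sIntegral_ind hμ c2] at h1
    have h0 := sIntegral_mono hμ (SF.const hF 0) sa fun x => abs_nonneg _
    rw [sIntegral_const hμ, zero_mul] at h0
    rw [Real.dist_eq, sub_zero, abs_of_nonneg h0]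
    linarith

end Helpers

/-- If `μ₁, μ₂` are bounded charges on a common field `𝒜`,
`f ≥ 0` is integrable w.r.t. both, `E` is a dense subset of `(0,∞)` with
`f⁻¹(y,∞)` in both Peano-Jordan completions for all `y ∈ E`, and
`μ̄₁(A) ≤ μ̄₂(A)` for each `A ∈ 𝒯 := {f⁻¹(y,∞) : y ∈ E}`, then
`∫ f dμ₁ ≤ ∫ f dμ₂` and, for each `A ∈ 𝒯`, `f·1_A` is integrable w.r.t. both with
`∫ f·1_A dμ₁ ≤ ∫ f·1_A dμ₂`. -/
theorem order_integrals {X : Type*} (𝒜 : Set (Set X)) (μ₁ μ₂ : Set X → ℝ)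
    (h1 : IsCharge 𝒜 μ₁) (h2 : IsCharge 𝒜 μ₂)
    (f : X → ℝ) (hf0 : ∀ x, 0 ≤ f x)
    (hf1 : MemL1 𝒜 μ₁ f) (hf2 : MemL1 𝒜 μ₂ f)
    (E : Set ℝ) (hEsub : E ⊆ Set.Ioi 0) (hEdense : Set.Ioi (0 : ℝ) ⊆ closure E)
    (hT : ∀ y ∈ E, f ⁻¹' Set.Ioi y ∈ pjField 𝒜 μ₁ ∧ f ⁻¹' Set.Ioi y ∈ pjField 𝒜 μ₂)
    (hle : ∀ y ∈ E, pjCharge 𝒜 μ₁ (f ⁻¹' Set.Ioi y) ≤ pjCharge 𝒜 μ₂ (f ⁻¹' Set.Ioi y)) :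
    chargeIntegral 𝒜 μ₁ f ≤ chargeIntegral 𝒜 μ₂ f ∧
    ∀ y ∈ E,
      MemL1 𝒜 μ₁ ((f ⁻¹' Set.Ioi y).indicator f) ∧
      MemL1 𝒜 μ₂ ((f ⁻¹' Set.Ioi y).indicator f) ∧
      chargeIntegral 𝒜 μ₁ ((f ⁻¹' Set.Ioi y).indicator f) ≤
        chargeIntegral 𝒜 μ₂ ((f ⁻¹' Set.Ioi y).indicator f) := by
  refine ⟨order_main μ₁ μ₂ h1 h2 f hf0 hf1 hf2 E hEdense (fun y hy => (hT y hy).1) hle,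
    fun y hy => ?_⟩
  have m1 := memL1_indicator h1 hf1 (hT y hy).1
  have m2 := memL1_indicator h2 hf2 (hT y hy).2
  have hy0 : 0 < y := hEsub hy
  have hpre : ∀ z ∈ E, ∃ w ∈ E,
      (f ⁻¹' Set.Ioi y).indicator f ⁻¹' Set.Ioi z = f ⁻¹' Set.Ioi w := by
    intro z hz
    have hz0 : 0 < z := hEsub hz
    refine ⟨max y z, by rcases max_choice y z with h | h <;> rw [h] <;> assumption, ?_⟩
    ext x
    by_cases hx : y < f x
    · have : x ∈ f ⁻¹' Set.Ioi y := hx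
      simp [Set.indicator_of_mem this, hx]
    · have : x ∉ f ⁻¹' Set.Ioi y := hx
      simp [Set.indicator_of_notMem this, hx, hz0.le]
  refine ⟨m1, m2, order_main μ₁ μ₂ h1 h2 _ (fun x => Set.indicator_nonneg (fun x _ => hf0 x) x)
    m1 m2 E hEdense (fun z hz => ?_) (fun z hz => ?_)⟩
  · obtain ⟨w, hw, e⟩ := hpre z hz
    rw [e]; exact (hT w hw).1
  · obtain ⟨w, hw, e⟩ := hpre z hz
    rw [e]; exact hle w hw
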